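/- Suppose each g_j is homogeneous of degree d_j with b_j > 0 and Assumption 2 holds, and let ρ̄_{j,d} (resp. ρ̲_{j,d}) denote the optimal value of the order-d sup (resp. inf) semidefinite relaxation of the second step for Ω_j. Then for every d, Σ_{j=1}^m ρ̲_{j,d} ≤ σ(∂Ω) ≤ Σ_{j=1}^m ρ̄_{j,d}, and both Σ_{j=1}^m ρ̲_{j,d} and Σ_{j=1}^m ρ̄_{j,d} converge monotonically to σ(∂Ω) as d → ∞. -/

import Mathlib

open MeasureTheory MvPolynomial Filter Topology
open scoped ENNReal

noncomputable section

/-- the monomial `x^α` -/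
def monom {n : ℕ} (α : Fin n → ℕ) (x : EuclideanSpace ℝ (Fin n)) : ℝ := ∏ i, x i ^ α i

/-- `|α| = α₁ + ⋯ + αₙ` -/
def degSum {n : ℕ} (α : Fin n → ℕ) : ℕ := ∑ i, α i

/-- evaluation of a polynomial at a point of Euclidean space -/
def pev {n : ℕ} (p : MvPolynomial (Fin n) ℝ) (x : EuclideanSpace ℝ (Fin n)) : ℝ :=
  eval (fun i => x i) p

/-- the Riesz functional `L_y` of a multisequence `y` -/
def riesz {n : ℕ} (y : (Fin n → ℕ) → ℝ) (p : MvPolynomial (Fin n) ℝ) : ℝ :=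
  ∑ m ∈ p.support, p.coeff m * y (fun i => m i)

/-- positive semidefiniteness of the localizing matrix `M(g·y)` with rows and columns
indexed by monomials of degree `≤ k` (equivalent quadratic-form formulation:
`0 ≤ L_y(g·p²)` for every polynomial `p` of degree `≤ k`). -/
def locPSD {n : ℕ} (y : (Fin n → ℕ) → ℝ) (g : MvPolynomial (Fin n) ℝ) (k : ℕ) : Prop :=
  ∀ p : MvPolynomial (Fin n) ℝ, p.totalDegree ≤ k → 0 ≤ riesz y (g * p ^ 2)

/-- the localizing matrix `M(g·y)` with rows/columns of degree `≤ k` vanishes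
(entrywise, extended bilinearly). -/
def locZero {n : ℕ} (y : (Fin n → ℕ) → ℝ) (g : MvPolynomial (Fin n) ℝ) (k : ℕ) : Prop :=
  ∀ p q : MvPolynomial (Fin n) ℝ, p.totalDegree ≤ k → q.totalDegree ≤ k →
    riesz y (g * (p * q)) = 0

/-- a Borel measure `μ` represents the multisequence `y` if all monomials are
`μ`-integrable with `∫ x^α dμ = y_α`. -/
def Represents {n : ℕ} (μ : Measure (EuclideanSpace ℝ (Fin n))) (y : (Fin n → ℕ) → ℝ) : Prop :=
  ∀ α : Fin n → ℕ, Integrable (monom α) μ ∧ ∫ x, monom α x ∂μ = y α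

/-- `‖∇g(x)‖²` -/
def gradSq {n : ℕ} (p : MvPolynomial (Fin n) ℝ) (x : EuclideanSpace ℝ (Fin n)) : ℝ :=
  ∑ i, (pev (pderiv i p) x) ^ 2

/-- `‖∇g(x)‖` -/
def gradNorm {n : ℕ} (p : MvPolynomial (Fin n) ℝ) (x : EuclideanSpace ℝ (Fin n)) : ℝ :=
  Real.sqrt (gradSq p x)

/-- `q(x) = ⟨x, ∇g(x)⟩` -/
def xGrad {n : ℕ} (p : MvPolynomial (Fin n) ℝ) (x : EuclideanSpace ℝ (Fin n)) : ℝ :=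
  ∑ i, x i * pev (pderiv i p) x

/-- the basic closed semi-algebraic set `Ω = {x | g_j(x) ≤ b_j, j = 1,…,m}` -/
def Om {n m : ℕ} (g : Fin m → MvPolynomial (Fin n) ℝ) (b : Fin m → ℝ) :
    Set (EuclideanSpace ℝ (Fin n)) :=
  {x | ∀ j, pev (g j) x ≤ b j}

/-- `Ω_j = {x ∈ Ω | g_j(x) = b_j}` -/
def OmJ {n m : ℕ} (g : Fin m → MvPolynomial (Fin n) ℝ) (b : Fin m → ℝ) (j : Fin m) :
    Set (EuclideanSpace ℝ (Fin n)) :=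
  {x | x ∈ Om g b ∧ pev (g j) x = b j}

/-- the open box `B = (−1,1)ⁿ` -/
def Box (n : ℕ) : Set (EuclideanSpace ℝ (Fin n)) := {x | ∀ i, |x i| < 1}

/-- the `(n−1)`-dimensional Hausdorff measure on `ℝⁿ` -/
def hsd (n : ℕ) : Measure (EuclideanSpace ℝ (Fin n)) := μH[(n : ℝ) - 1]

/-- `σ_j`: the restriction to `Ω_j` of the `(n−1)`-dimensional Hausdorff measure -/
def sigmaJ {n m : ℕ} (g : Fin m → MvPolynomial (Fin n) ℝ) (b : Fin m → ℝ) (j : Fin m) :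
    Measure (EuclideanSpace ℝ (Fin n)) :=
  (hsd n).restrict (OmJ g b j)

/-- `φ_j`: the measure `dφ_j = ‖∇g_j‖⁻¹ dσ_j` on `Ω_j` -/
def phiJ {n m : ℕ} (g : Fin m → MvPolynomial (Fin n) ℝ) (b : Fin m → ℝ) (j : Fin m) :
    Measure (EuclideanSpace ℝ (Fin n)) :=
  (sigmaJ g b j).withDensity fun x => ENNReal.ofReal (gradNorm (g j) x)⁻¹


/-- lift a polynomial in `x` to a polynomial in `(x, z)` -/
def liftP {n : ℕ} (p : MvPolynomial (Fin n) ℝ) : MvPolynomial (Fin (n + 1)) ℝ :=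
  rename Fin.castSucc p

/-- the variable `z` -/
def zP (n : ℕ) : MvPolynomial (Fin (n + 1)) ℝ := X (Fin.last n)

/-- `θ(x,z) = z² − ‖∇g(x)‖²` as a polynomial in `(x, z)` -/
def thetaP {n : ℕ} (p : MvPolynomial (Fin n) ℝ) : MvPolynomial (Fin (n + 1)) ℝ :=
  zP n ^ 2 - ∑ i : Fin n, liftP (pderiv i p) ^ 2

/-- the multi-index `(α, k) ∈ ℕ^{n+1}` -/
def idxZ {n : ℕ} (α : Fin n → ℕ) (k : ℕ) : Fin (n + 1) → ℕ := Fin.snoc α k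

/-- the moments `v_{j,α} = ∫_{Ω_j} x^α dφ_j` of `φ_j` -/
def phiMom {n m : ℕ} (g : Fin m → MvPolynomial (Fin n) ℝ) (b : Fin m → ℝ) (j : Fin m)
    (α : Fin n → ℕ) : ℝ := ∫ x, monom α x ∂(phiJ g b j)

/-- feasibility for the order-`d` second-step semidefinite program
\eqref{second-step}/\eqref{second-step-inf}, with data `v` (the moments of `φ_j`),
over finite sequences `u = (u_{α,k})_{|(α,k)|≤2d}`: `u_{α,0} = v_α` for `|α| ≤ 2d`,
`M_d(u) ⪰ 0`, `M_{d−ℓ}(θ·u) = 0`, `M_{d−1}((τ−z²)·u) ⪰ 0` and `M_{d−1}(z·u) ⪰ 0`. -/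
def FeasSDP2 {n : ℕ} (θ : MvPolynomial (Fin (n + 1)) ℝ) (τ : ℝ) (ℓ : ℕ)
    (v : (Fin n → ℕ) → ℝ) (d : ℕ) (u : (Fin (n + 1) → ℕ) → ℝ) : Prop :=
  (∀ γ : Fin (n + 1) → ℕ, 2 * d < degSum γ → u γ = 0) ∧
  (∀ α : Fin n → ℕ, degSum α ≤ 2 * d → u (idxZ α 0) = v α) ∧
  (∀ p : MvPolynomial (Fin (n + 1)) ℝ, p.totalDegree ≤ d → 0 ≤ riesz u (p ^ 2)) ∧
  locZero u θ (d - ℓ) ∧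
  locPSD u (C τ - zP n ^ 2) (d - 1) ∧
  locPSD u (zP n) (d - 1)

/-- optimality for the `sup`-version \eqref{second-step} of the second-step SDP -/
def IsMaxSDP2 {n : ℕ} (θ : MvPolynomial (Fin (n + 1)) ℝ) (τ : ℝ) (ℓ : ℕ)
    (v : (Fin n → ℕ) → ℝ) (d : ℕ) (u : (Fin (n + 1) → ℕ) → ℝ) : Prop :=
  FeasSDP2 θ τ ℓ v d u ∧
  ∀ u', FeasSDP2 θ τ ℓ v d u' → u' (idxZ (fun _ => 0) 1) ≤ u (idxZ (fun _ => 0) 1)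

/-- optimality for the `inf`-version \eqref{second-step-inf} of the second-step SDP -/
def IsMinSDP2 {n : ℕ} (θ : MvPolynomial (Fin (n + 1)) ℝ) (τ : ℝ) (ℓ : ℕ)
    (v : (Fin n → ℕ) → ℝ) (d : ℕ) (u : (Fin (n + 1) → ℕ) → ℝ) : Prop :=
  FeasSDP2 θ τ ℓ v d u ∧
  ∀ u', FeasSDP2 θ τ ℓ v d u' → u (idxZ (fun _ => 0) 1) ≤ u' (idxZ (fun _ => 0) 1)

lemma riesz_eq_sum {n : ℕ} (y : (Fin n → ℕ) → ℝ) (p : MvPolynomial (Fin n) ℝ)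
    (s : Finset (Fin n →₀ ℕ)) (h : p.support ⊆ s) :
    riesz y p = ∑ m ∈ s, p.coeff m * y (fun i => m i) := by
  unfold riesz
  apply Finset.sum_subset h
  intro m _ hm
  rw [notMem_support_iff.mp hm, zero_mul]

lemma riesz_add {n : ℕ} (y : (Fin n → ℕ) → ℝ) (p q : MvPolynomial (Fin n) ℝ) :
    riesz y (p + q) = riesz y p + riesz y q := by
  classical
  rw [riesz_eq_sum y (p + q) (p.support ∪ q.support) support_add,
    riesz_eq_sum y p (p.support ∪ q.support) Finset.subset_union_left,
    riesz_eq_sum y q (p.support ∪ q.support) Finset.subset_union_right,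
    ← Finset.sum_add_distrib]
  refine Finset.sum_congr rfl fun m _ => ?_
  rw [coeff_add]; ring

lemma riesz_C_mul {n : ℕ} (y : (Fin n → ℕ) → ℝ) (c : ℝ) (p : MvPolynomial (Fin n) ℝ) :
    riesz y (C c * p) = c * riesz y p := by
  classical
  have h : (C c * p).support ⊆ p.support := by
    intro m hm
    rw [mem_support_iff, coeff_C_mul] at hm
    rw [mem_support_iff]
    exact right_ne_zero_of_mul hm
  rw [riesz_eq_sum y (C c * p) p.support h]
  unfold riesz
  rw [Finset.mul_sum]
  refine Finset.sum_congr rfl fun m _ => ?_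
  rw [coeff_C_mul]; ring

lemma riesz_neg {n : ℕ} (y : (Fin n → ℕ) → ℝ) (p : MvPolynomial (Fin n) ℝ) :
    riesz y (-p) = - riesz y p := by
  have := riesz_C_mul y (-1) p
  simpa using this

lemma riesz_sub {n : ℕ} (y : (Fin n → ℕ) → ℝ) (p q : MvPolynomial (Fin n) ℝ) :
    riesz y (p - q) = riesz y p - riesz y q := by
  rw [sub_eq_add_neg, riesz_add, riesz_neg]; ring

lemma riesz_sum {n : ℕ} {ι : Type*} (y : (Fin n → ℕ) → ℝ) (s : Finset ι)
    (p : ι → MvPolynomial (Fin n) ℝ) :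
    riesz y (∑ i ∈ s, p i) = ∑ i ∈ s, riesz y (p i) := by
  classical
  induction s using Finset.induction_on with
  | empty => simp [riesz]
  | insert a s ha ih => rw [Finset.sum_insert ha, Finset.sum_insert ha, riesz_add, ih]

lemma riesz_monomial {n : ℕ} (y : (Fin n → ℕ) → ℝ) (m : Fin n →₀ ℕ) (c : ℝ) :
    riesz y (monomial m c) = c * y (fun i => m i) := by
  classical
  rw [riesz_eq_sum y _ {m} support_monomial_subset]
  simp

lemma degSum_le {n : ℕ} (p : MvPolynomial (Fin n) ℝ) (m : Fin n →₀ ℕ) (hm : m ∈ p.support) :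
    degSum (fun i => m i) ≤ p.totalDegree := by
  have h := le_totalDegree hm
  rw [Finsupp.sum_fintype _ _ (fun _ => rfl)] at h
  exact h

lemma riesz_congr {n N : ℕ} (y y' : (Fin n → ℕ) → ℝ) (p : MvPolynomial (Fin n) ℝ)
    (hp : p.totalDegree ≤ N) (h : ∀ γ, degSum γ ≤ N → y γ = y' γ) :
    riesz y p = riesz y' p := by
  unfold riesz
  refine Finset.sum_congr rfl fun m hm => ?_
  rw [h _ ((degSum_le p m hm).trans hp)]

lemma riesz_liftP {n N : ℕ} (u : (Fin (n + 1) → ℕ) → ℝ) (v : (Fin n → ℕ) → ℝ)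
    (p : MvPolynomial (Fin n) ℝ) (hp : p.totalDegree ≤ N)
    (h : ∀ α : Fin n → ℕ, degSum α ≤ N → u (idxZ α 0) = v α) :
    riesz u (liftP p) = riesz v p := by
  conv_lhs => rw [p.as_sum]
  unfold liftP
  rw [map_sum, riesz_sum]
  unfold riesz
  refine Finset.sum_congr rfl fun m hm => ?_
  rw [rename_monomial]
  have := riesz_monomial u (m.mapDomain Fin.castSucc) (p.coeff m)
  unfold riesz at this
  rw [this, ← h _ ((degSum_le p m hm).trans hp)]
  congr 2
  funext i
  refine Fin.lastCases ?_ (fun i => ?_) i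
  · rw [idxZ, Fin.snoc_last, Finsupp.mapDomain_of_notMem_range]
    rintro ⟨x, hx⟩
    exact (Fin.castSucc_lt_last x).ne hx
  · rw [idxZ, Fin.snoc_castSucc, Finsupp.mapDomain_apply (Fin.castSucc_injective n)]

lemma riesz_integral {n : ℕ} (μ : Measure (EuclideanSpace ℝ (Fin n)))
    (hi : ∀ α : Fin n → ℕ, Integrable (monom α) μ) (p : MvPolynomial (Fin n) ℝ) :
    riesz (fun α => ∫ x, monom α x ∂μ) p = ∫ x, pev p x ∂μ := by
  have : ∀ x, pev p x = ∑ m ∈ p.support, p.coeff m * monom (fun i => m i) x := by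
    intro x
    unfold pev monom
    rw [eval_eq']
  simp_rw [this]
  rw [integral_finsetSum _ (fun m _ => (hi _).const_mul _)]
  unfold riesz
  refine Finset.sum_congr rfl fun m _ => ?_
  rw [integral_const_mul]

lemma riesz_CS {n d : ℕ} (u : (Fin n → ℕ) → ℝ)
    (h : ∀ p : MvPolynomial (Fin n) ℝ, p.totalDegree ≤ d → 0 ≤ riesz u (p ^ 2))
    (p q : MvPolynomial (Fin n) ℝ) (hp : p.totalDegree ≤ d) (hq : q.totalDegree ≤ d) :
    riesz u (p * q) ^ 2 ≤ riesz u (p ^ 2) * riesz u (q ^ 2) := by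
  have key : ∀ t : ℝ, 0 ≤ riesz u (q ^ 2) * (t * t) + (2 * riesz u (p * q)) * t
      + riesz u (p ^ 2) := by
    intro t
    have h1 : (p + C t * q).totalDegree ≤ d := by
      refine (totalDegree_add _ _).trans (max_le hp ((totalDegree_mul _ _).trans ?_))
      rw [totalDegree_C]; omega
    have h2 := h _ h1
    have h3 : (p + C t * q) ^ 2 = p ^ 2 + C (2 * t) * (p * q) + C (t * t) * q ^ 2 := by
      simp only [C_mul, map_ofNat]; ring
    rw [h3, riesz_add, riesz_add, riesz_C_mul, riesz_C_mul] at h2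
    linarith
  have := discrim_le_zero key
  unfold discrim at this
  nlinarith

lemma riesz_z {n : ℕ} (u : (Fin (n + 1) → ℕ) → ℝ) (k : ℕ) :
    riesz u (zP n ^ k) = u (idxZ (fun _ => 0) k) := by
  unfold zP
  rw [X_pow_eq_monomial, riesz_monomial, one_mul]
  congr 1
  funext i
  refine Fin.lastCases ?_ (fun i => ?_) i
  · simp [idxZ]
  · simp [idxZ]

lemma approx_sqrt (c T δ : ℝ) (hc : 0 < c) (hδ : 0 < δ) :
    ∃ r : Polynomial ℝ, ∀ t ∈ Set.Icc (c ^ 2) T, |r.eval t ^ 2 + c - √t| ≤ δ := by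
  set M := √(√T)
  have hM : 0 ≤ M := Real.sqrt_nonneg _
  set δ' := min 1 (δ / (2 * M + 1)) with hδ'
  have hpos : 0 < δ' := lt_min one_pos (by positivity)
  obtain ⟨r, hr⟩ := exists_polynomial_near_of_continuousOn (c ^ 2) T (fun t => √(√t - c))
    (by fun_prop) δ' hpos
  refine ⟨r, fun t ht => ?_⟩
  have h1 := (abs_lt.mp (hr t ht))
  have hct : c ≤ √t := Real.le_sqrt_of_sq_le ht.1
  have hw : √(√t - c) ≤ M := Real.sqrt_le_sqrt (by
    have := Real.sqrt_le_sqrt ht.2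
    linarith)
  have hw0 := Real.sqrt_nonneg (√t - c)
  have hws : √(√t - c) ^ 2 = √t - c := Real.sq_sqrt (by linarith)
  have e1 : δ' ≤ 1 := min_le_left _ _
  have e2 : δ' * (2 * M + 1) ≤ δ := by
    have := min_le_right 1 (δ / (2 * M + 1))
    rw [← hδ'] at this
    rwa [le_div_iff₀ (by positivity)] at this
  generalize √(√t - c) = w at *
  have : r.eval t ^ 2 + c - √t = (r.eval t - w) * (r.eval t + w) := by nlinarith
  rw [this, abs_mul]
  have a1 : |r.eval t - w| ≤ δ' := (abs_lt.mpr h1).le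
  have a2 : |r.eval t + w| ≤ 2 * M + 1 := by
    rw [abs_le]; constructor <;> linarith
  calc _ ≤ δ' * (2 * M + 1) := mul_le_mul a1 a2 (abs_nonneg _) hpos.le
    _ ≤ δ := e2

lemma continuous_pev {n : ℕ} (p : MvPolynomial (Fin n) ℝ) : Continuous (pev p) := by
  unfold pev
  have := MvPolynomial.continuous_eval p
  exact this.comp (by fun_prop)

lemma continuous_gradNorm {n : ℕ} (p : MvPolynomial (Fin n) ℝ) : Continuous (gradNorm p) := by
  unfold gradNorm gradSq
  have := fun i => continuous_pev (pderiv i p)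
  fun_prop

lemma continuous_monom {n : ℕ} (α : Fin n → ℕ) : Continuous (monom α) := by
  unfold monom
  fun_prop

lemma integrable_of_cpt {n : ℕ} (μ : Measure (EuclideanSpace ℝ (Fin n))) [IsFiniteMeasure μ]
    (K : Set (EuclideanSpace ℝ (Fin n))) (hK : IsCompact K) (hμ : ∀ᵐ x ∂μ, x ∈ K)
    (f : EuclideanSpace ℝ (Fin n) → ℝ) (hf : Continuous f) : Integrable f μ := by
  have := hf.continuousOn.integrableOn_compact (μ := μ) hK
  rwa [IntegrableOn, Measure.restrict_eq_self_of_ae_mem hμ] at this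

lemma integral_le_of_cpt {n : ℕ} (μ : Measure (EuclideanSpace ℝ (Fin n))) [IsFiniteMeasure μ]
    (K : Set (EuclideanSpace ℝ (Fin n))) (hμ : ∀ᵐ x ∂μ, x ∈ K)
    (f : EuclideanSpace ℝ (Fin n) → ℝ) (a : ℝ) (hf : ∀ x ∈ K, |f x| ≤ a) :
    |∫ x, f x ∂μ| ≤ a * μ.real Set.univ := by
  rw [← Real.norm_eq_abs]
  exact norm_integral_le_of_norm_le_const (hμ.mono fun x hx => by
    rw [Real.norm_eq_abs]; exact hf x hx)

lemma liftP_mul {n : ℕ} (p q : MvPolynomial (Fin n) ℝ) : liftP (p * q) = liftP p * liftP q :=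
  map_mul _ _ _

set_option maxHeartbeats 2000000 in
lemma conv_key {n : ℕ} (μ : Measure (EuclideanSpace ℝ (Fin n))) [IsFiniteMeasure μ]
    (K : Set (EuclideanSpace ℝ (Fin n))) (hK : IsCompact K) (hμ : ∀ᵐ x ∂μ, x ∈ K)
    (g : MvPolynomial (Fin n) ℝ) (hpos : ∀ x ∈ K, gradNorm g x ≠ 0) (τ : ℝ) (ℓ : ℕ)
    (ε : ℝ) (hε : 0 < ε) :
    ∃ d₀, ∀ d, d₀ ≤ d → ∀ u, FeasSDP2 (thetaP g) τ ℓ (fun α => ∫ x, monom α x ∂μ) d u →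
      |u (idxZ (fun _ => 0) 1) - ∫ x, gradNorm g x ∂μ| ≤ ε := by
  have hmi : ∀ α : Fin n → ℕ, Integrable (monom α) μ := fun α =>
    integrable_of_cpt μ K hK hμ _ (continuous_monom α)
  obtain ⟨c, hc, hcK⟩ := hK.exists_forall_le' (continuous_gradNorm g).continuousOn
    (a := 0) (fun x hx => lt_of_le_of_ne (Real.sqrt_nonneg _) (hpos x hx).symm)
  obtain ⟨F, hF⟩ := hK.exists_bound_of_continuousOn (continuous_gradNorm g).continuousOn
  have hFK : ∀ x ∈ K, gradNorm g x ≤ |F| := fun x hx =>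
    (le_abs_self _).trans ((hF x hx).trans (le_abs_self _))
  generalize |F| = F' at hFK
  obtain ⟨F₁, hF₁, hFK⟩ : ∃ F₁, 0 ≤ F₁ ∧ ∀ x ∈ K, gradNorm g x ≤ F₁ :=
    ⟨|F'|, abs_nonneg _, fun x hx => (hFK x hx).trans (le_abs_self _)⟩
  set M := μ.real Set.univ with hM
  have hM0 : 0 ≤ M := measureReal_nonneg
  set Q := (M + 1) * ((2 * F₁ + 1) / c + 1) with hQ
  have hQ0 : 0 < Q := by positivity
  obtain ⟨δ, hδ, hδ1, hδ2⟩ : ∃ δ : ℝ, 0 < δ ∧ δ ≤ 1 ∧ δ * Q ≤ ε := by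
    refine ⟨min 1 (ε / Q), lt_min one_pos (by positivity), min_le_left _ _, ?_⟩
    rw [← le_div_iff₀ hQ0]; exact min_le_right _ _
  obtain ⟨r, hr⟩ := approx_sqrt c (F₁ ^ 2) δ hc hδ
  set S : MvPolynomial (Fin n) ℝ := ∑ i, pderiv i g ^ 2 with hS
  have hSev : ∀ x, pev S x = gradNorm g x ^ 2 := by
    intro x
    have h0 : 0 ≤ gradSq g x := Finset.sum_nonneg fun i _ => sq_nonneg _
    rw [gradNorm, Real.sq_sqrt h0]
    simp [pev, hS, gradSq]
  set k : MvPolynomial (Fin n) ℝ := Polynomial.aeval S r with hk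
  have hkev : ∀ x, pev k x = r.eval (gradNorm g x ^ 2) := by
    intro x
    rw [← hSev]
    have := Polynomial.hom_eval₂ r (algebraMap ℝ (MvPolynomial (Fin n) ℝ))
      (eval (fun i => x i)) S
    simp only [pev, hk, Polynomial.aeval_def]
    rw [this, ← Polynomial.eval₂_id]
    congr 1
    ext a
    simp
  set h : MvPolynomial (Fin n) ℝ := k ^ 2 + C c with hh
  have hhev : ∀ x ∈ K, |pev h x - gradNorm g x| ≤ δ := by
    intro x hx
    have h1 := hr (gradNorm g x ^ 2) ⟨pow_le_pow_left₀ hc.le (hcK x hx) 2,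
      pow_le_pow_left₀ (hc.le.trans (hcK x hx)) (hFK x hx) 2⟩
    rw [Real.sqrt_sq (hc.le.trans (hcK x hx)), ← hkev] at h1
    simpa [pev, hh] using h1
  set H := liftP h with hH
  set P := zP n - H with hP
  set R := liftP (S - h ^ 2) with hR
  set Kk := liftP k with hKk
  refine ⟨1 + ℓ + P.totalDegree + R.totalDegree + (Kk * P).totalDegree + h.totalDegree
    + ((S - h ^ 2) ^ 2).totalDegree, ?_⟩
  rintro d hd u ⟨-, hu1, hu2, hu3, -, hu5⟩
  have hL : ∀ p : MvPolynomial (Fin n) ℝ, p.totalDegree ≤ 2 * d →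
      riesz u (liftP p) = ∫ x, pev p x ∂μ := by
    intro p hp
    rw [riesz_liftP u _ p hp hu1, riesz_integral μ hmi]
  have hHe : H = Kk ^ 2 + C c := by
    simp [hH, hh, hKk, liftP]
  have hθ : thetaP g = zP n ^ 2 - liftP S := by
    simp [thetaP, liftP, hS]
  have hRe : R = liftP S - H ^ 2 := by
    simp [hR, hH, liftP]
  -- the main identity
  have id1 : zP n * P ^ 2 + (Kk * P) ^ 2 + C c * P ^ 2 = thetaP g * (P * 1) + R * P := by
    have : zP n * P ^ 2 + (Kk * P) ^ 2 + C c * P ^ 2 = (zP n + H) * P ^ 2 := by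
      rw [hHe]; ring
    rw [this, hθ, hRe, hP]; ring
  have id2 := congrArg (riesz u) id1
  rw [riesz_add, riesz_add, riesz_C_mul, riesz_add] at id2
  have z1 := hu3 P 1 (by omega) (by simp)
  have z2 := hu5 P (by omega)
  have z3 := hu2 (Kk * P) (by omega)
  have A0 := hu2 P (by omega)
  have cs1 := riesz_CS u hu2 R P (by omega) (by omega)
  have cs2 := riesz_CS u hu2 1 P (by simp) (by omega)
  have l1 : riesz u (1 ^ 2) = M := by
    have : (1 : MvPolynomial (Fin (n + 1)) ℝ) ^ 2 = liftP 1 := by simp [liftP]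
    rw [this, hL 1 (by simp)]
    simp [pev, hM]
  have lP : riesz u (1 * P) = u (idxZ (fun _ => 0) 1) - ∫ x, pev h x ∂μ := by
    have h1 := riesz_z u 1
    rw [pow_one] at h1
    rw [one_mul, hP, riesz_sub, h1, hH, hL h (by omega)]
  have lR : riesz u (R ^ 2) ≤ (δ * (2 * F₁ + 1)) ^ 2 * M := by
    have : R ^ 2 = liftP ((S - h ^ 2) ^ 2) := by simp [hR, liftP]
    rw [this, hL _ (by omega)]
    refine (le_abs_self _).trans (integral_le_of_cpt μ K hμ _ _ fun x hx => ?_)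
    have e1 : pev ((S - h ^ 2) ^ 2) x = (gradNorm g x ^ 2 - pev h x ^ 2) ^ 2 := by
      rw [← hSev]; simp [pev]
    rw [e1, abs_of_nonneg (sq_nonneg _), sq_le_sq, abs_of_nonneg
      (show 0 ≤ δ * (2 * F₁ + 1) by positivity)]
    have e2 : gradNorm g x ^ 2 - pev h x ^ 2
      = -(pev h x - gradNorm g x) * (gradNorm g x + pev h x) := by ring
    rw [e2, abs_mul, abs_neg]
    have e3 := hhev x hx
    have e4 := abs_le.mp e3
    have e5 := hFK x hx
    have e6 := hcK x hx
    refine mul_le_mul e3 ?_ (abs_nonneg _) hδ.le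
    rw [abs_le]; constructor <;> linarith
  have hdiff : |(∫ x, pev h x ∂μ) - ∫ x, gradNorm g x ∂μ| ≤ δ * M := by
    rw [← integral_sub (integrable_of_cpt μ K hK hμ _ (continuous_pev h))
      (integrable_of_cpt μ K hK hμ _ (continuous_gradNorm g))]
    exact integral_le_of_cpt μ K hμ _ _ hhev
  rw [l1, lP] at cs2
  rw [z1, zero_add] at id2
  have hc1 : c * riesz u (P ^ 2) ≤ riesz u (R * P) := by linarith
  have hc2 : c ^ 2 * riesz u (P ^ 2) ≤ riesz u (R ^ 2) := by
    rcases A0.eq_or_lt with h0 | h0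
    · rw [← h0, mul_zero]
      have := hu2 R (by omega)
      exact this
    · have : (c * riesz u (P ^ 2)) ^ 2 ≤ riesz u (R * P) ^ 2 :=
        pow_le_pow_left₀ (by positivity) hc1 2
      refine le_of_mul_le_mul_right ?_ h0
      nlinarith
  set X0 := u (idxZ (fun _ => 0) 1)
  have hfin : (c * (X0 - ∫ x, pev h x ∂μ)) ^ 2 ≤ (M * (δ * (2 * F₁ + 1))) ^ 2 := by
    have t1 : c ^ 2 * (X0 - ∫ x, pev h x ∂μ) ^ 2 ≤ c ^ 2 * (M * riesz u (P ^ 2)) :=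
      mul_le_mul_of_nonneg_left cs2 (sq_nonneg c)
    have t2 : M * (c ^ 2 * riesz u (P ^ 2)) ≤ M * ((δ * (2 * F₁ + 1)) ^ 2 * M) :=
      mul_le_mul_of_nonneg_left (hc2.trans lR) hM0
    nlinarith
  rw [sq_le_sq, abs_mul, abs_of_pos hc, abs_of_nonneg
    (show 0 ≤ M * (δ * (2 * F₁ + 1)) by positivity)] at hfin
  have hfin2 : |X0 - ∫ x, pev h x ∂μ| ≤ δ * M * ((2 * F₁ + 1) / c) := by
    have : δ * M * ((2 * F₁ + 1) / c) = (M * (δ * (2 * F₁ + 1))) / c := by ring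
    rw [this, le_div_iff₀ hc]; linarith
  have tri := abs_sub_le X0 (∫ x, pev h x ∂μ) (∫ x, gradNorm g x ∂μ)
  have : δ * M * ((2 * F₁ + 1) / c) + δ * M ≤ δ * Q := by
    have w : 0 ≤ (2 * F₁ + 1) / c := by positivity
    rw [hQ]
    generalize (2 * F₁ + 1) / c = w' at *
    nlinarith [mul_nonneg hδ.le w]
  linarith

lemma totalDegree_liftP_le {n : ℕ} (p : MvPolynomial (Fin n) ℝ) :
    (liftP p).totalDegree ≤ p.totalDegree := totalDegree_rename_le _ _

lemma totalDegree_zP (n : ℕ) : (zP n).totalDegree = 1 := totalDegree_X _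

lemma totalDegree_pderiv_le' {n D : ℕ} (g : MvPolynomial (Fin n) ℝ) (hg : g.IsHomogeneous D)
    (i : Fin n) : (pderiv i g).totalDegree ≤ g.totalDegree - 1 := by
  by_cases h0 : g = 0
  · simp [h0]
  · rw [hg.totalDegree h0]
    exact hg.pderiv.totalDegree_le

lemma totalDegree_thetaP {n D : ℕ} (g : MvPolynomial (Fin n) ℝ) (hg : g.IsHomogeneous D)
    (h2 : 2 ≤ g.totalDegree) : (thetaP g).totalDegree ≤ 2 * (g.totalDegree - 1) := by
  unfold thetaP
  refine (totalDegree_sub _ _).trans (max_le ?_ ?_)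
  · refine (totalDegree_pow _ _).trans ?_
    rw [totalDegree_zP]; omega
  · refine totalDegree_finsetSum_le fun i _ => ?_
    refine (totalDegree_pow _ _).trans ?_
    have := (totalDegree_liftP_le (pderiv i g)).trans (totalDegree_pderiv_le' g hg i)
    omega

/-- truncation of a feasible sequence -/
lemma feas_trunc {n ℓ d₁ d₂ : ℕ} (θ : MvPolynomial (Fin (n + 1)) ℝ) (τ : ℝ)
    (v : (Fin n → ℕ) → ℝ) (hθ : θ.totalDegree ≤ 2 * ℓ) (hℓ : ℓ ≤ d₁) (h1 : 1 ≤ d₁)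
    (h12 : d₁ ≤ d₂) (u : (Fin (n + 1) → ℕ) → ℝ) (hu : FeasSDP2 θ τ ℓ v d₂ u) :
    FeasSDP2 θ τ ℓ v d₁ (fun γ => if 2 * d₁ < degSum γ then 0 else u γ) := by
  obtain ⟨-, hu1, hu2, hu3, hu4, hu5⟩ := hu
  have hr : ∀ p : MvPolynomial (Fin (n + 1)) ℝ, p.totalDegree ≤ 2 * d₁ →
      riesz (fun γ => if 2 * d₁ < degSum γ then 0 else u γ) p = riesz u p := by
    intro p hp
    refine riesz_congr _ _ p hp fun γ hγ => ?_
    simp [not_lt.mpr hγ]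
  refine ⟨fun γ hγ => by simp [hγ], ?_, ?_, ?_, ?_, ?_⟩
  · intro α hα
    have : degSum (idxZ α 0) = degSum α := by
      simp [degSum, idxZ, Fin.sum_univ_castSucc]
    simp only [this, not_lt.mpr hα, if_false]
    exact hu1 α (by omega)
  · intro p hp
    rw [hr _ ((totalDegree_pow _ _).trans (by omega))]
    exact hu2 p (by omega)
  · intro p q hp hq
    rw [hr]
    · exact hu3 p q (by omega) (by omega)
    · have a1 := totalDegree_mul θ (p * q)
      have a2 := totalDegree_mul p q
      omega
  · intro p hp
    rw [hr]
    · exact hu4 p (by omega)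
    · have a1 := totalDegree_mul (C τ - zP n ^ 2) (p ^ 2)
      have a2 := totalDegree_pow p 2
      have a3 := totalDegree_sub (C τ) (zP n ^ 2)
      have a4 := totalDegree_pow (zP n) 2
      rw [totalDegree_zP] at a4
      rw [totalDegree_C, Nat.zero_max] at a3
      omega
  · intro p hp
    rw [hr]
    · exact hu5 p (by omega)
    · have a1 := totalDegree_mul (zP n) (p ^ 2)
      have a2 := totalDegree_pow p 2
      rw [totalDegree_zP] at a1
      omega

lemma feas_zero {n ℓ d : ℕ} (θ : MvPolynomial (Fin (n + 1)) ℝ) (τ : ℝ)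
    (v : (Fin n → ℕ) → ℝ) (hd : 1 ≤ d) (u : (Fin (n + 1) → ℕ) → ℝ)
    (hu : FeasSDP2 θ τ ℓ v d u) (h0 : u (idxZ (fun _ => 0) 0) = 0) :
    u (idxZ (fun _ => 0) 1) = 0 := by
  have h := riesz_CS u hu.2.2.1 1 (zP n) (by simp) (by rw [totalDegree_zP]; exact hd)
  have e1 := riesz_z u 0
  have e2 := riesz_z u 1
  rw [pow_zero, h0] at e1
  rw [pow_one] at e2
  rw [one_pow, one_mul, e1, e2, zero_mul] at h
  exact pow_eq_zero_iff (two_ne_zero) |>.mp (le_antisymm h (sq_nonneg _))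

/-- in the degree one case the literal truncated program forces the mass to vanish -/
lemma feas_linear {n d : ℕ} (c : ℝ) (hc : c ≠ 0) (θ : MvPolynomial (Fin (n + 1)) ℝ) (τ : ℝ)
    (hθ : θ = zP n ^ 2 - C c)
    (v : (Fin n → ℕ) → ℝ) (u : (Fin (n + 1) → ℕ) → ℝ)
    (hu : FeasSDP2 θ τ 0 v d u) : u (idxZ (fun _ => 0) 0) = 0 := by
  obtain ⟨hu0, -, -, hu3, -, -⟩ := hu
  have step : ∀ i, i ≤ d → u (idxZ (fun _ => 0) (2 * (i + 1))) = c * u (idxZ (fun _ => 0) (2 * i)) := by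
    intro i hi
    have hd : (zP n ^ i).totalDegree ≤ d - 0 := by
      refine (totalDegree_pow _ _).trans ?_
      rw [totalDegree_zP]; omega
    have h := hu3 (zP n ^ i) (zP n ^ i) hd hd
    have e : θ * (zP n ^ i * zP n ^ i) = zP n ^ (2 * (i + 1)) - C c * zP n ^ (2 * i) := by
      rw [hθ]; ring
    rw [e, riesz_sub, riesz_C_mul, riesz_z, riesz_z] at h
    linarith
  have all : ∀ i, i ≤ d + 1 → u (idxZ (fun _ => 0) (2 * i)) = c ^ i * u (idxZ (fun _ => 0) 0) := by
    intro i
    induction i with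
    | zero => intro _; simp
    | succ i ih =>
      intro hi
      rw [step i (by omega), ih (by omega)]; ring
  have h1 := all (d + 1) le_rfl
  rw [hu0 _ (by simp [degSum, idxZ, Fin.sum_univ_castSucc])] at h1
  rcases mul_eq_zero.mp h1.symm with h | h
  · exact absurd h (pow_ne_zero _ hc)
  · exact h

lemma hasStrict_pev {n : ℕ} (p : MvPolynomial (Fin n) ℝ) (x : EuclideanSpace ℝ (Fin n)) :
    HasStrictFDerivAt (pev p)
      (∑ i, pev (pderiv i p) x • (EuclideanSpace.proj i : EuclideanSpace ℝ (Fin n) →L[ℝ] ℝ)) x := by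
  induction p using MvPolynomial.induction_on with
  | C a =>
    have : pev (C a : MvPolynomial (Fin n) ℝ) = fun _ => a := by
      funext y; simp [pev]
    rw [this]
    simpa [pev] using hasStrictFDerivAt_const a x
  | add p q hp hq =>
    have : pev (p + q) = fun y => pev p y + pev q y := by
      funext y; simp [pev]
    rw [this]
    refine (hp.add hq).congr_fderiv ?_
    rw [← Finset.sum_add_distrib]
    refine Finset.sum_congr rfl fun i _ => ?_
    rw [← add_smul]
    simp [pev]
  | mul_X p i hp =>
    have : pev (p * X i) = fun y => pev p y * (EuclideanSpace.proj i : _ →L[ℝ] ℝ) y := by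
      funext y; simp [pev]
    rw [this]
    have hX := (EuclideanSpace.proj i : EuclideanSpace ℝ (Fin n) →L[ℝ] ℝ).hasStrictFDerivAt (x := x)
    refine (hp.mul hX).congr_fderiv ?_
    ext w
    simp [pev, Derivation.leibniz, pderiv_X, Pi.single_apply, Finset.mul_sum, apply_ite, mul_comm]
    simp [mul_add, Finset.sum_add_distrib, mul_left_comm]

/-- local finiteness of the Hausdorff measure of a level set at a regular point -/
lemma hsd_local {n : ℕ} (p : MvPolynomial (Fin n) ℝ) (c : ℝ) (x : EuclideanSpace ℝ (Fin n))
    (hx : gradNorm p x ≠ 0) :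
    ∃ s ∈ 𝓝 x, hsd n (s ∩ {y | pev p y = c}) < ⊤ := by
  set v : EuclideanSpace ℝ (Fin n) := WithLp.toLp 2 (fun i => pev (pderiv i p) x) with hv
  have hvn : ‖v‖ = gradNorm p x := by
    rw [EuclideanSpace.norm_eq]
    simp [hv, gradNorm, gradSq]
  have hv0 : 0 < ‖v‖ := by
    rw [hvn]; exact lt_of_le_of_ne (Real.sqrt_nonneg _) hx.symm
  have hv0' : v ≠ 0 := norm_pos_iff.mp hv0
  have hder : HasStrictFDerivAt (pev p) (innerSL ℝ v) x := by
    refine (hasStrict_pev p x).congr_fderiv ?_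
    ext w
    simp [hv, PiLp.inner_apply, mul_comm]
  have hev : ∀ᶠ q : EuclideanSpace ℝ (Fin n) × EuclideanSpace ℝ (Fin n) in 𝓝 (x, x),
      ‖pev p q.1 - pev p q.2 - innerSL ℝ v (q.1 - q.2)‖ ≤ (‖v‖ / 2) * ‖q.1 - q.2‖ :=
    hder.isLittleO.def (by positivity)
  rw [nhds_prod_eq, Filter.eventually_iff, Filter.mem_prod_self_iff] at hev
  obtain ⟨s, hs, hsp⟩ := hev
  refine ⟨s ∩ Metric.ball x 1, inter_mem hs (Metric.ball_mem_nhds x one_pos), ?_⟩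
  set T := s ∩ Metric.ball x 1 ∩ {y | pev p y = c} with hT
  let V := (ℝ ∙ v)ᗮ
  let P : EuclideanSpace ℝ (Fin n) →L[ℝ] V := V.orthogonalProjectionOnto
  let f : T → V := fun y => P y
  have hanti : AntilipschitzWith 2 f := by
    refine AntilipschitzWith.of_le_mul_dist fun y z => ?_
    rw [Subtype.dist_eq, dist_eq_norm, dist_eq_norm]
    have h1 := hsp (Set.mk_mem_prod y.2.1.1 z.2.1.1)
    have h2 : pev p (y : EuclideanSpace ℝ (Fin n)) = c := y.2.2
    have h3 : pev p (z : EuclideanSpace ℝ (Fin n)) = c := z.2.2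
    simp only [Set.mem_ofPred_eq, h2, h3, sub_self, zero_sub, norm_neg, innerSL_apply_apply] at h1
    have h4 : f y - f z = P ((y : EuclideanSpace ℝ (Fin n)) - z) := by
      simp [f]
    rw [h4]
    generalize ((y : EuclideanSpace ℝ (Fin n)) - z) = w at h1
    -- pythagoras
    have h5 : ‖w‖ ^ 2 = ‖(ℝ ∙ v).orthogonalProjectionOnto w‖ ^ 2 + ‖P w‖ ^ 2 :=
      Submodule.norm_sq_eq_add_norm_sq_projection w (ℝ ∙ v)
    have h6 : ‖(ℝ ∙ v).orthogonalProjectionOnto w‖ ≤ ‖w‖ / 2 := by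
      rw [Submodule.coe_norm, ← Submodule.starProjection_apply,
        Submodule.starProjection_singleton, norm_smul, norm_div]
      simp only [RCLike.ofReal_real_eq_id, id, norm_pow, norm_norm]
      rw [div_mul_eq_mul_div, div_le_iff₀ (by positivity)]
      nlinarith
    have h7 := norm_nonneg w
    have h8 := norm_nonneg ((ℝ ∙ v).orthogonalProjectionOnto w)
    have h9 : ‖w‖ ^ 2 ≤ (2 * ‖P w‖) ^ 2 := by nlinarith
    exact_mod_cast abs_le_of_sq_le_sq' h9 (by positivity) |>.2
  have hn : 1 ≤ n := by
    rcases Nat.eq_zero_or_pos n with h | h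
    · subst h
      exact absurd (Subsingleton.elim v 0) hv0'
    · exact h
  have : Fact (Module.finrank ℝ (EuclideanSpace ℝ (Fin n)) = (n - 1) + 1) :=
    ⟨by simp; omega⟩
  have hfr : Module.finrank ℝ V = n - 1 := Submodule.finrank_orthogonal_span_singleton hv0'
  have hnc : ((n - 1 : ℕ) : ℝ) = (n : ℝ) - 1 := by push_cast [hn]; ring
  have hfin : (μH[(n : ℝ) - 1] : Measure V) (Set.range f) < ⊤ := by
    rw [← hnc, ← hfr]
    have hb : Bornology.IsBounded (Set.range f) := by
      have h1 : Set.range f ⊆ P '' (Metric.ball x 1) := by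
        rintro _ ⟨y, rfl⟩
        exact ⟨y, y.2.1.2, rfl⟩
      exact (P.lipschitz.isBounded_image Metric.isBounded_ball).subset h1
    exact hb.measure_lt_top
  have h1 := hanti.le_hausdorffMeasure_image (d := (n : ℝ) - 1) (by rw [← hnc]; positivity)
    Set.univ
  rw [Set.image_univ] at h1
  have h2 : hsd n T = (μH[(n : ℝ) - 1] : Measure T) Set.univ := by
    have := (isometry_subtype_coe (s := T)).hausdorffMeasure_image (d := (n : ℝ) - 1)
      (Or.inl (by rw [← hnc]; positivity)) Set.univ
    rw [← this]; simp [hsd]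
  rw [h2]
  refine h1.trans_lt (ENNReal.mul_lt_top ?_ hfin)
  exact ENNReal.rpow_lt_top_of_nonneg (by rw [← hnc]; positivity) (by simp)

lemma hsd_finite {n m : ℕ} (g : Fin m → MvPolynomial (Fin n) ℝ) (b : Fin m → ℝ)
    (hcomp : IsCompact (Om g b)) (j : Fin m)
    (hgrad : ∀ x ∈ OmJ g b j, gradNorm (g j) x ≠ 0) :
    IsCompact (OmJ g b j) ∧ hsd n (OmJ g b j) < ⊤ := by
  have hcl : IsClosed {x | pev (g j) x = b j} :=
    isClosed_eq (continuous_pev _) continuous_const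
  have hK : IsCompact (OmJ g b j) := hcomp.inter_right hcl
  refine ⟨hK, ?_⟩
  have : ∀ x ∈ OmJ g b j, ∃ t ∈ 𝓝[OmJ g b j] x, hsd n t < ⊤ := by
    intro x hx
    obtain ⟨s, hs, hfin⟩ := hsd_local (g j) (b j) x (hgrad x hx)
    refine ⟨s ∩ {y | pev (g j) y = b j}, ?_, hfin⟩
    refine inter_mem (mem_nhdsWithin_of_mem_nhds hs) ?_
    filter_upwards [self_mem_nhdsWithin] with y hy using hy.2
  exact hK.measure_lt_top_of_nhdsWithin this

lemma phiJ_facts {n m : ℕ} (g : Fin m → MvPolynomial (Fin n) ℝ) (b : Fin m → ℝ) (j : Fin m)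
    (hK : IsCompact (OmJ g b j)) (hfin : hsd n (OmJ g b j) < ⊤)
    (hgrad : ∀ x ∈ OmJ g b j, gradNorm (g j) x ≠ 0) :
    IsFiniteMeasure (phiJ g b j) ∧ (∀ᵐ x ∂(phiJ g b j), x ∈ OmJ g b j) ∧
      ∫ x, gradNorm (g j) x ∂(phiJ g b j) = (hsd n (OmJ g b j)).toReal := by
  have hms : MeasurableSet (OmJ g b j) := hK.isClosed.measurableSet
  have hσ : IsFiniteMeasure (sigmaJ g b j) := by
    refine ⟨?_⟩
    rw [sigmaJ, Measure.restrict_apply_univ]; exact hfin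
  have hae : ∀ᵐ x ∂(sigmaJ g b j), x ∈ OmJ g b j := ae_restrict_mem hms
  have hint : Integrable (fun x => (gradNorm (g j) x)⁻¹) (sigmaJ g b j) := by
    have h1 : ContinuousOn (fun x => (gradNorm (g j) x)⁻¹) (OmJ g b j) :=
      (continuous_gradNorm (g j)).continuousOn.inv₀ hgrad
    have := h1.integrableOn_compact (μ := sigmaJ g b j) hK
    rwa [IntegrableOn, Measure.restrict_eq_self_of_ae_mem hae] at this
  have hmeas : Measurable (fun x => ENNReal.ofReal (gradNorm (g j) x)⁻¹) :=
    (continuous_gradNorm (g j)).measurable.inv.ennreal_ofReal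
  refine ⟨isFiniteMeasure_withDensity_ofReal hint.2,
    (withDensity_absolutelyContinuous _ _).ae_le hae, ?_⟩
  rw [phiJ, integral_withDensity_eq_integral_toReal_smul hmeas
    (Eventually.of_forall fun _ => ENNReal.ofReal_lt_top)]
  have : (fun x => (ENNReal.ofReal (gradNorm (g j) x)⁻¹).toReal • gradNorm (g j) x)
      =ᵐ[sigmaJ g b j] fun _ => (1 : ℝ) := by
    filter_upwards [hae] with x hx
    rw [ENNReal.toReal_ofReal (inv_nonneg.mpr (show 0 ≤ gradNorm (g j) x from Real.sqrt_nonneg _)), smul_eq_mul,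
      inv_mul_cancel₀ (hgrad x hx)]
  rw [integral_congr_ae this]
  simp [sigmaJ, Measure.real]

/-- low degree: the mass variable vanishes for every feasible point -/
lemma feas_low {n m : ℕ} (g : Fin m → MvPolynomial (Fin n) ℝ) (b : Fin m → ℝ) (j : Fin m)
    {D : ℕ} (hhom : (g j).IsHomogeneous D) (hlow : (g j).totalDegree ≤ 1)
    (hgrad : ∀ x ∈ OmJ g b j, gradNorm (g j) x ≠ 0) (τ : ℝ) (d : ℕ) (hd : 1 ≤ d)
    (u : (Fin (n + 1) → ℕ) → ℝ)
    (hu : FeasSDP2 (thetaP (g j)) τ ((g j).totalDegree - 1) (phiMom g b j) d u) :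
    u (idxZ (fun _ => 0) 1) = 0 := by
  refine feas_zero _ _ _ hd u hu ?_
  have hC : ∀ i, ∃ a, pderiv i (g j) = C a := by
    intro i
    have := totalDegree_pderiv_le' (g j) hhom i
    exact ⟨_, totalDegree_eq_zero_iff_eq_C.mp (by omega)⟩
  choose a ha using hC
  have hθ : thetaP (g j) = zP n ^ 2 - C (∑ i, a i ^ 2) := by
    simp [thetaP, liftP, ha]
  have hg : ∀ x, gradSq (g j) x = ∑ i, a i ^ 2 := by
    intro x; simp [gradSq, ha, pev]
  have hl : (g j).totalDegree - 1 = 0 := by omega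
  by_cases hc : ∑ i, a i ^ 2 = 0
  · have hem : OmJ g b j = ∅ := by
      rw [Set.eq_empty_iff_forall_notMem]
      intro x hx
      exact hgrad x hx (by rw [gradNorm, hg, hc, Real.sqrt_zero])
    rw [hu.2.1 (fun _ => 0) (by simp [degSum])]
    simp [phiMom, phiJ, sigmaJ, hem]
  · rw [hl] at hu
    exact feas_linear _ hc _ τ hθ _ u hu

/-- In the homogeneous case with Assumption 2, if `ρ̄_{j,d}` (resp.
`ρ̲_{j,d}`) denotes the optimal value of the order-`d` sup (resp. inf) second-step
semidefinite relaxation for `Ω_j` (here: the value `u_{0,1}` of any optimal solution),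
then for every `d`, `Σ_j ρ̲_{j,d} ≤ σ(∂Ω) ≤ Σ_j ρ̄_{j,d}`, and both sums converge
monotonically to `σ(∂Ω)` as `d → ∞`. -/
theorem statement14 {n m : ℕ} (g : Fin m → MvPolynomial (Fin n) ℝ) (b : Fin m → ℝ)
    (D : Fin m → ℕ) (τ : Fin m → ℝ)
    (hcomp : IsCompact (Om g b))
    (hbox : Om g b ⊆ Box n)
    (hbpos : ∀ j, 0 < b j)
    (hhom : ∀ j, (g j).IsHomogeneous (D j))
    (hgrad : ∀ j, ∀ x ∈ OmJ g b j, gradNorm (g j) x ≠ 0)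
    (hass2 : ∀ j k : Fin m, k ≠ j → sigmaJ g b j {x | pev (g k) x = b k} = 0)
    (hbd : frontier (Om g b) = ⋃ j, OmJ g b j)
    (hτ : ∀ j, ∀ x ∈ OmJ g b j, gradSq (g j) x < τ j)
    (U W : Fin m → ℕ → (Fin (n + 1) → ℕ) → ℝ)
    (hopt : ∀ (j : Fin m) (d : ℕ),
      max 1 (max (Finset.univ.sup fun k => ((g k).totalDegree + 1) / 2)
        (Finset.univ.sup fun k => (g k).totalDegree - 1)) ≤ d →
      IsMaxSDP2 (thetaP (g j)) (τ j) ((g j).totalDegree - 1) (phiMom g b j) d (U j d) ∧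
      IsMinSDP2 (thetaP (g j)) (τ j) ((g j).totalDegree - 1) (phiMom g b j) d (W j d)) :
    (∀ d : ℕ,
      max 1 (max (Finset.univ.sup fun k => ((g k).totalDegree + 1) / 2)
        (Finset.univ.sup fun k => (g k).totalDegree - 1)) ≤ d →
      (∑ j, W j d (idxZ (fun _ => 0) 1)) ≤ ((hsd n) (frontier (Om g b))).toReal ∧
      ((hsd n) (frontier (Om g b))).toReal ≤ ∑ j, U j d (idxZ (fun _ => 0) 1)) ∧
    (∀ d₁ d₂ : ℕ,
      max 1 (max (Finset.univ.sup fun k => ((g k).totalDegree + 1) / 2)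
        (Finset.univ.sup fun k => (g k).totalDegree - 1)) ≤ d₁ → d₁ ≤ d₂ →
      (∑ j, W j d₁ (idxZ (fun _ => 0) 1)) ≤ (∑ j, W j d₂ (idxZ (fun _ => 0) 1)) ∧
      (∑ j, U j d₂ (idxZ (fun _ => 0) 1)) ≤ (∑ j, U j d₁ (idxZ (fun _ => 0) 1))) ∧
    Tendsto (fun d => ∑ j, W j d (idxZ (fun _ => 0) 1)) atTop
      (nhds ((hsd n) (frontier (Om g b))).toReal) ∧
    Tendsto (fun d => ∑ j, U j d (idxZ (fun _ => 0) 1)) atTop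
      (nhds ((hsd n) (frontier (Om g b))).toReal) := by
  set N := max 1 (max (Finset.univ.sup fun k => ((g k).totalDegree + 1) / 2)
        (Finset.univ.sup fun k => (g k).totalDegree - 1)) with hN
  have hN1 : 1 ≤ N := le_max_left _ _
  have hNd : ∀ j, (g j).totalDegree - 1 ≤ N := fun j =>
    (Finset.le_sup (f := fun k => (g k).totalDegree - 1) (Finset.mem_univ j)).trans
      ((le_max_right _ _).trans (le_max_right _ _))
  have hfin := fun j => hsd_finite g b hcomp j (hgrad j)
  -- total mass of the boundary
  have hsum : ((hsd n) (frontier (Om g b))).toReal = ∑ j, (hsd n (OmJ g b j)).toReal := by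
    rw [hbd, measure_iUnion₀, tsum_fintype, ENNReal.toReal_sum fun j _ => (hfin j).2.ne]
    · intro j k hjk
      have h := hass2 j k hjk.symm
      rw [sigmaJ, Measure.restrict_apply'
        (hfin j).1.isClosed.measurableSet] at h
      have hsub : OmJ g b j ∩ OmJ g b k ⊆ {x | pev (g k) x = b k} ∩ OmJ g b j :=
        fun x hx => ⟨hx.2.2, hx.1⟩
      exact measure_mono_null hsub h
    · exact fun j => (hfin j).1.isClosed.measurableSet.nullMeasurableSet
  -- convergence of every term
  have hconv : ∀ (j : Fin m) (Y : ℕ → (Fin (n + 1) → ℕ) → ℝ),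
      (∀ d, N ≤ d → FeasSDP2 (thetaP (g j)) (τ j) ((g j).totalDegree - 1) (phiMom g b j) d (Y d)) →
      Tendsto (fun d => Y d (idxZ (fun _ => 0) 1)) atTop (nhds (hsd n (OmJ g b j)).toReal) := by
    intro j Y hY
    obtain ⟨f1, f2, f3⟩ := phiJ_facts g b j (hfin j).1 (hfin j).2 (hgrad j)
    rw [Metric.tendsto_atTop]
    intro ε hε
    obtain ⟨d₀, hd₀⟩ := conv_key (phiJ g b j) (OmJ g b j) (hfin j).1 f2 (g j) (hgrad j) (τ j)
      ((g j).totalDegree - 1) (ε / 2) (half_pos hε)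
    refine ⟨max N d₀, fun d hd => ?_⟩
    have := hd₀ d ((le_max_right _ _).trans hd) (Y d) (hY d ((le_max_left _ _).trans hd))
    rw [f3] at this
    rw [Real.dist_eq]
    linarith
  have hmono : ∀ (j : Fin m) (d₁ d₂ : ℕ), N ≤ d₁ → d₁ ≤ d₂ →
      W j d₁ (idxZ (fun _ => 0) 1) ≤ W j d₂ (idxZ (fun _ => 0) 1) ∧
      U j d₂ (idxZ (fun _ => 0) 1) ≤ U j d₁ (idxZ (fun _ => 0) 1) := by
    intro j d₁ d₂ h1 h12
    obtain ⟨⟨a1, a2⟩, ⟨a3, a4⟩⟩ := hopt j d₁ h1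
    obtain ⟨⟨b1, -⟩, ⟨b3, -⟩⟩ := hopt j d₂ (h1.trans h12)
    by_cases hlow : (g j).totalDegree ≤ 1
    · have key := fun d hd u hu =>
        feas_low g b j (hhom j) hlow (hgrad j) (τ j) d hd u hu
      rw [key d₁ (hN1.trans h1) _ a1, key d₁ (hN1.trans h1) _ a3,
        key d₂ ((hN1.trans h1).trans h12) _ b1, key d₂ ((hN1.trans h1).trans h12) _ b3]
      exact ⟨le_rfl, le_rfl⟩
    · have hθ := totalDegree_thetaP (g j) (hhom j) (by omega)
      have tr := fun u hu => feas_trunc (thetaP (g j)) (τ j) (phiMom g b j) hθ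
        ((hNd j).trans h1) (hN1.trans h1) h12 u hu
      have hdeg : ¬ (2 * d₁ < degSum (idxZ (fun _ : Fin n => 0) 1)) := by
        have : degSum (idxZ (fun _ : Fin n => 0) 1) = 1 := by
          simp [degSum, idxZ, Fin.sum_univ_castSucc]
        omega
      have c1 := a2 _ (tr _ b1)
      have c2 := a4 _ (tr _ b3)
      simp only [hdeg, if_false] at c1 c2
      exact ⟨c2, c1⟩
  have hWt := fun j => hconv j (W j) fun d hd => (hopt j d hd).2.1
  have hUt := fun j => hconv j (U j) fun d hd => (hopt j d hd).1.1
  rw [hsum]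
  refine ⟨fun d hd => ⟨Finset.sum_le_sum fun j _ => ?_, Finset.sum_le_sum fun j _ => ?_⟩,
    fun d₁ d₂ h1 h12 => ⟨Finset.sum_le_sum fun j _ => (hmono j d₁ d₂ h1 h12).1,
      Finset.sum_le_sum fun j _ => (hmono j d₁ d₂ h1 h12).2⟩,
    tendsto_finsetSum _ fun j _ => hWt j, tendsto_finsetSum _ fun j _ => hUt j⟩
  · refine ge_of_tendsto (hWt j) ?_
    filter_upwards [eventually_ge_atTop d] with d' hd' using (hmono j d d' hd hd').1
  · refine le_of_tendsto (hUt j) ?_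
    filter_upwards [eventually_ge_atTop d] with d' hd' using (hmono j d d' hd hd').2
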